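/- For α ∈ (0,1) and n > 1, there exists a piecewise polynomial f_d on [2^{-n}, 1], consisting of n pieces each of degree at most d (one on each segment [2^{-i-1}, 2^{-i}], i = 0,…,n−1), such that sup_{t ∈ [2^{-n},1]} |t^α − f_d(t)| ≤ (2/(2+√8))·(3+√8)^{-d}. -/

import Mathlib

open Real

lemma rpa_choose_succ (α : ℝ) (k : ℕ) :
    ((k : ℝ) + 1) * Ring.choose α (k + 1) = Ring.choose α k * (α - k) := by
  have h := Ring.choose_smul_choose α (Nat.le_succ k)
  simp only [Nat.succ_eq_add_one, Nat.choose_succ_self_right, Nat.add_sub_cancel_left,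
    Ring.choose_one_right, nsmul_eq_mul] at h
  push_cast at h
  exact h

lemma rpa_choose_bound (α : ℝ) (h0 : 0 < α) (h1 : α < 1) (k : ℕ) :
    |Ring.choose α (k + 2)| ≤ 1 / 2 := by
  induction k with
  | zero =>
    have h := rpa_choose_succ α 1
    rw [Ring.choose_one_right] at h
    norm_num at h
    rw [abs_le]
    constructor <;> norm_num <;> nlinarith
  | succ k ih =>
    have h := rpa_choose_succ α (k + 2)
    have hk : (0 : ℝ) ≤ k := k.cast_nonneg
    have h2 := congrArg abs h
    rw [abs_mul, abs_mul] at h2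
    push_cast at h2
    rw [abs_of_pos (by positivity : (0 : ℝ) < (k : ℝ) + 2 + 1),
      abs_of_neg (by linarith : α - ((k : ℝ) + 2) < 0)] at h2
    have h3 : |Ring.choose α (k + 2)| * -(α - ((k : ℝ) + 2)) ≤ 1 / 2 * (k + 2 + 1) := by
      apply mul_le_mul ih (by linarith) (by linarith) (by norm_num)
    rw [← h2] at h3
    have h4 : (0 : ℝ) < (k : ℝ) + 2 + 1 := by positivity
    rw [mul_comm (1 / 2 : ℝ)] at h3
    exact le_of_mul_le_mul_left h3 h4

lemma rpa_choose_bound_one (α : ℝ) (h0 : 0 < α) (h1 : α < 1) (k : ℕ) :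
    |Ring.choose α k| ≤ 1 := by
  match k with
  | 0 => simp
  | 1 => rw [Ring.choose_one_right, abs_of_pos h0]; exact h1.le
  | k + 2 => exact (rpa_choose_bound α h0 h1 k).trans (by norm_num)

lemma rpa_hasSum (α : ℝ) (w : ℂ) (hw : ‖w‖ < 1) :
    HasSum (fun k : ℕ => ((Ring.choose α k : ℝ) : ℂ) * w ^ k) ((1 + w) ^ (α : ℂ)) := by
  have h := (Complex.one_add_cpow_hasFPowerSeriesOnBall_zero (a := (α : ℂ))).hasSum
    (y := w) (by simpa [Metric.mem_eball, edist_zero_right, ← ofReal_norm] using hw)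
  simp only [binomialSeries_apply, zero_add, List.ofFn_const, List.prod_replicate,
    smul_eq_mul] at h
  simpa only [Complex.ofReal_choose] using h

lemma rpa_approx (α r : ℝ) (h0 : 0 < α) (h1 : α < 1) (hr0 : 0 < r) (hr1 : r < 1)
    (d : ℕ) (hd : 1 ≤ d) (w : ℂ) (hw : ‖w‖ = r) :
    |‖(1 + w) ^ (α : ℂ)‖ ^ 2
      - ‖∑ k ∈ Finset.range (d + 1), ((Ring.choose α k : ℝ) : ℂ) * w ^ k‖ ^ 2|
      ≤ r ^ (d + 1) / (1 - r) ^ 2 := by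
  have hs := rpa_hasSum α w (by rw [hw]; exact hr1)
  set S := ∑ k ∈ Finset.range (d + 1), ((Ring.choose α k : ℝ) : ℂ) * w ^ k with hS
  set g := (1 + w) ^ (α : ℂ) with hg
  have hn : ∀ k, ‖((Ring.choose α k : ℝ) : ℂ) * w ^ k‖ = |Ring.choose α k| * r ^ k := by
    intro k
    rw [norm_mul, norm_pow, hw, Complex.norm_real, Real.norm_eq_abs]
  have hgeo : HasSum (fun k : ℕ => r ^ k) (1 - r)⁻¹ := hasSum_geometric_of_lt_one hr0.le hr1
  have hgn : ‖g‖ ≤ (1 - r)⁻¹ := by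
    rw [← hs.tsum_eq]
    refine tsum_of_norm_bounded hgeo fun k => ?_
    rw [hn]
    exact mul_le_of_le_one_left (by positivity) (rpa_choose_bound_one α h0 h1 k)
  have hSn : ‖S‖ ≤ (1 - r)⁻¹ := by
    refine (norm_sum_le _ _).trans ?_
    refine (Finset.sum_le_sum fun k _ => ?_).trans
      (hgeo.summable.sum_le_tsum (Finset.range (d + 1)) (fun i _ => by positivity) |>.trans
        hgeo.tsum_eq.le)
    rw [hn]
    exact mul_le_of_le_one_left (by positivity) (rpa_choose_bound_one α h0 h1 k)
  have hd1 : ‖g - S‖ ≤ 1 / 2 * r ^ (d + 1) * (1 - r)⁻¹ := by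
    have ht := (hasSum_nat_add_iff' (d + 1)).mpr hs
    rw [← ht.tsum_eq]
    refine tsum_of_norm_bounded (hgeo.mul_left (1 / 2 * r ^ (d + 1))) fun k => ?_
    rw [hn]
    obtain ⟨e, rfl⟩ := Nat.exists_eq_add_of_le hd
    have := rpa_choose_bound α h0 h1 (k + e)
    rw [show k + (1 + e + 1) = k + e + 2 by ring]
    calc _ ≤ 1 / 2 * r ^ (k + e + 2) := by gcongr
      _ = _ := by ring
  have hfac : ‖g‖ ^ 2 - ‖S‖ ^ 2 = (‖g‖ - ‖S‖) * (‖g‖ + ‖S‖) := by ring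
  rw [hfac, abs_mul, abs_of_nonneg (by positivity : 0 ≤ ‖g‖ + ‖S‖)]
  have hinv : 0 < (1 - r)⁻¹ := inv_pos.mpr (by linarith)
  calc _ ≤ (1 / 2 * r ^ (d + 1) * (1 - r)⁻¹) * ((1 - r)⁻¹ + (1 - r)⁻¹) := by
        apply mul_le_mul ((abs_norm_sub_norm_le g S).trans hd1) (by linarith) (by positivity)
          (by positivity)
    _ = _ := by field_simp; ring

open Polynomial in
lemma rpa_normSq (c : ℕ → ℝ) (r θ : ℝ) (N : ℕ) :
    ‖∑ k ∈ Finset.range N, ((c k : ℝ) : ℂ) * ((r : ℂ) * Complex.exp (θ * Complex.I)) ^ k‖ ^ 2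
      = (∑ j ∈ Finset.range N, ∑ l ∈ Finset.range N,
          C (c j * c l * r ^ (j + l)) * Chebyshev.T ℝ ((j : ℤ) - (l : ℤ))).eval (cos θ) := by
  have hk : ∀ k : ℕ, ((c k : ℝ) : ℂ) * ((r : ℂ) * Complex.exp (θ * Complex.I)) ^ k
      = ((c k * r ^ k * cos (k * θ) : ℝ) : ℂ) + ((c k * r ^ k * sin (k * θ) : ℝ) : ℂ) * Complex.I := by
    intro k
    rw [mul_pow, ← Complex.exp_nat_mul,
      show (k : ℂ) * (θ * Complex.I) = ((k * θ : ℝ) : ℂ) * Complex.I by push_cast; ring,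
      Complex.exp_mul_I]
    push_cast
    ring
  simp_rw [hk]
  rw [Finset.sum_add_distrib, ← Finset.sum_mul, ← Complex.ofReal_sum, ← Complex.ofReal_sum,
    ← Complex.normSq_eq_norm_sq, Complex.normSq_add_mul_I, sq, sq, Finset.sum_mul_sum,
    Finset.sum_mul_sum, ← Finset.sum_add_distrib, eval_finsetSum]
  refine Finset.sum_congr rfl fun j _ => ?_
  rw [← Finset.sum_add_distrib, eval_finsetSum]
  refine Finset.sum_congr rfl fun l _ => ?_
  rw [eval_mul, eval_C, Chebyshev.T_real_cos]
  push_cast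
  rw [sub_mul, cos_sub, pow_add]
  ring

open Polynomial in
lemma rpa_core (α : ℝ) (h0 : 0 < α) (h1 : α < 1) (d : ℕ) (hd : 1 ≤ d) :
    ∃ Q : ℝ[X], Q.natDegree ≤ d ∧ ∀ x ∈ Set.Icc (-1 : ℝ) 1,
      |((3 + x) / 4) ^ α - Q.eval x| ≤ 2 / (2 + √8) * (3 + √8) ^ (-(d : ℝ)) := by
  have h8 : √8 ^ 2 = 8 := Real.sq_sqrt (by norm_num)
  have h8p : 0 ≤ √8 := Real.sqrt_nonneg 8
  have h8l : 2.82 < √8 := by nlinarith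
  have h8u : √8 < 2.83 := by nlinarith
  obtain ⟨r, hr⟩ : ∃ r, r = 3 - √8 := ⟨_, rfl⟩
  have hr0 : 0 < r := by linarith
  have hr1 : r < 1 := by linarith
  have hrr : r ^ 2 + 1 = 6 * r := by rw [hr]; nlinarith
  have hinv : 3 + √8 = r⁻¹ := by
    apply eq_inv_of_mul_eq_one_left
    rw [hr]
    nlinarith
  set c : ℕ → ℝ := fun k => Ring.choose α k with hc
  set P : ℝ[X] := ∑ j ∈ Finset.range (d + 1), ∑ l ∈ Finset.range (d + 1),
          C (c j * c l * r ^ (j + l)) * Chebyshev.T ℝ ((j : ℤ) - (l : ℤ)) with hP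
  refine ⟨C (((8 * r) ^ α)⁻¹) * P, ?_, ?_⟩
  · refine (natDegree_C_mul_le _ _).trans ?_
    refine natDegree_sum_le_of_forall_le _ _ fun j hj => ?_
    refine natDegree_sum_le_of_forall_le _ _ fun l hl => ?_
    refine (natDegree_C_mul_le _ _).trans ?_
    rw [Chebyshev.natDegree_T]
    simp only [Finset.mem_range] at hj hl
    omega
  · intro x hx
    obtain ⟨θ, rfl⟩ : ∃ θ, cos θ = x := ⟨arccos x, cos_arccos hx.1 hx.2⟩
    set w : ℂ := (r : ℂ) * Complex.exp (θ * Complex.I) with hw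
    have hwn : ‖w‖ = r := by
      rw [hw, norm_mul, Complex.norm_exp_ofReal_mul_I, mul_one, Complex.norm_real,
        Real.norm_eq_abs, abs_of_pos hr0]
    have hA := rpa_approx α r h0 h1 hr0 hr1 d hd w hwn
    have hB := rpa_normSq c r θ (d + 1)
    rw [← hw, ← hP] at hB
    rw [hB] at hA
    have hnorm : ‖1 + w‖ ^ 2 = (8 * r) * ((3 + cos θ) / 4) := by
      rw [← Complex.normSq_eq_norm_sq, hw, Complex.exp_mul_I, ← Complex.ofReal_cos,
        ← Complex.ofReal_sin,
        show (1 : ℂ) + r * ((cos θ : ℝ) + (sin θ : ℝ) * Complex.I)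
          = ((1 + r * cos θ : ℝ) : ℂ) + ((r * sin θ : ℝ) : ℂ) * Complex.I by push_cast; ring,
        Complex.normSq_add_mul_I]
      linear_combination hrr + r ^ 2 * Real.sin_sq_add_cos_sq θ
    have ht : 0 ≤ (3 + cos θ) / 4 := by linarith [hx.1]
    have hg : ‖(1 + w) ^ (α : ℂ)‖ ^ 2 = (8 * r) ^ α * ((3 + cos θ) / 4) ^ α := by
      rw [Complex.norm_cpow_real, ← Real.mul_rpow (by positivity) ht, ← hnorm,
        ← Real.rpow_natCast, ← Real.rpow_natCast, ← Real.rpow_mul (norm_nonneg _),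
        ← Real.rpow_mul (norm_nonneg _), mul_comm]
    rw [hg] at hA
    have h8r : 1 ≤ (8 * r) ^ α := Real.one_le_rpow (by linarith) h0.le
    set K := (8 * r) ^ α with hK
    have hK0 : 0 < K := by linarith
    have e : ((3 + cos θ) / 4) ^ α - (C K⁻¹ * P).eval (cos θ)
        = K⁻¹ * (K * ((3 + cos θ) / 4) ^ α - P.eval (cos θ)) := by
      rw [eval_mul, eval_C]; field_simp
    rw [e, abs_mul, abs_of_pos (inv_pos.mpr hK0)]
    refine (mul_le_of_le_one_left (abs_nonneg _) (inv_le_one_of_one_le₀ h8r)).trans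
      (hA.trans ?_)
    have h2 : 2 + √8 = (1 - r) / r := by
      rw [sub_div, div_self hr0.ne', one_div, ← hinv]; ring
    rw [h2, hinv, Real.rpow_neg (by positivity), Real.rpow_natCast, inv_pow, inv_inv]
    have h1r : 0 < 1 - r := by linarith
    have e2 : 2 / ((1 - r) / r) * r ^ d = r ^ (d + 1) * (2 * (1 - r)) / (1 - r) ^ 2 := by
      field_simp
      ring
    rw [e2]
    gcongr
    exact le_mul_of_one_le_right (by positivity) (by linarith)

/-- `t^α` admits an `n`-piece piecewise polynomial approximation on `[2^{-n}, 1]`,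
with one degree-`≤ d` polynomial on each segment `[2^{-i-1}, 2^{-i}]`, `i = 0,…,n−1`,
with uniform error at most `(2/(2+√8))·(3+√8)^{-d}`. -/
theorem rpow_piecewise_approx (α : ℝ) (hα : α ∈ Set.Ioo (0 : ℝ) 1)
    (d : ℕ) (hd : 1 ≤ d) (n : ℕ) (hn : 1 < n) :
    ∃ p : ℕ → Polynomial ℝ, (∀ i < n, (p i).degree ≤ d) ∧
      ∀ i < n, ∀ t ∈ Set.Icc ((2 : ℝ) ^ (-(i : ℝ) - 1)) ((2 : ℝ) ^ (-(i : ℝ))),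
        |t ^ α - (p i).eval t| ≤ 2 / (2 + Real.sqrt 8) * (3 + Real.sqrt 8) ^ (-(d : ℝ)) := by
  obtain ⟨Q, hQd, hQ⟩ := rpa_core α hα.1 hα.2 d hd
  refine ⟨fun i => Polynomial.C ((((2 : ℝ) ^ i) ^ α)⁻¹) *
    Q.comp (Polynomial.C (4 * 2 ^ i) * Polynomial.X + Polynomial.C (-3)), ?_, ?_⟩
  · intro i _
    apply Polynomial.degree_le_of_natDegree_le
    refine (Polynomial.natDegree_C_mul_le _ _).trans ?_
    refine Polynomial.natDegree_comp_le.trans ?_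
    calc _ ≤ d * 1 := Nat.mul_le_mul hQd Polynomial.natDegree_linear_le
      _ = d := mul_one d
  · intro i _ t ht
    have hp : (0 : ℝ) < 2 ^ i := by positivity
    rw [Real.rpow_sub (by norm_num), Real.rpow_neg (by norm_num), Real.rpow_natCast,
      Real.rpow_one] at ht
    have ha : 1 / 2 ≤ 2 ^ i * t := by
      have := mul_le_mul_of_nonneg_left ht.1 hp.le
      rwa [← mul_div_assoc, mul_inv_cancel₀ hp.ne'] at this
    have hb : 2 ^ i * t ≤ 1 := by
      have := mul_le_mul_of_nonneg_left ht.2 hp.le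
      rwa [mul_inv_cancel₀ hp.ne'] at this
    have ht0 : 0 ≤ t := le_trans (by positivity) ht.1
    have h := hQ (4 * 2 ^ i * t + -3) ⟨by linarith, by linarith⟩
    rw [show (3 + (4 * 2 ^ i * t + -3)) / 4 = 2 ^ i * t by ring,
      Real.mul_rpow hp.le ht0] at h
    have hK1 : 1 ≤ ((2 : ℝ) ^ i) ^ α :=
      Real.one_le_rpow (one_le_pow₀ (by norm_num)) hα.1.le
    set K := ((2 : ℝ) ^ i) ^ α with hK
    have hK0 : 0 < K := by linarith
    simp only [Polynomial.eval_mul, Polynomial.eval_C, Polynomial.eval_comp, Polynomial.eval_add,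
      Polynomial.eval_X]
    have e : t ^ α - K⁻¹ * Q.eval (4 * 2 ^ i * t + -3)
        = K⁻¹ * (K * t ^ α - Q.eval (4 * 2 ^ i * t + -3)) := by
      field_simp
    rw [e, abs_mul, abs_of_pos (inv_pos.mpr hK0)]
    exact (mul_le_of_le_one_left (abs_nonneg _) (inv_le_one_of_one_le₀ hK1)).trans h
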